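/- Let λ₁, …, λ_ℓ ∈ ℂ be pairwise distinct with λ_k ≠ i/2 and λ_k − λ_j ≠ i for all j ≠ k, satisfying the Bethe ansatz equations. Then for every λ ∈ ℂ \ {λ₁,…,λ_ℓ}, the Bethe vector Ψ = B_N(λ₁) ⋯ B_N(λ_ℓ) |0⟩_N satisfies τ_N(λ) Ψ = Λ(λ; λ₁,…,λ_ℓ) Ψ. -/

import Mathlib

open Complex Matrix Filter Topology

noncomputable section

/-- The index set of the standard basis of `𝔥_N = (ℂ²)^{⊗N}`. -/
abbrev St (N : ℕ) := Fin N → Fin 2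

/-- The Pauli matrices `σ¹, σ², σ³`. -/
def pauli : Fin 3 → Matrix (Fin 2) (Fin 2) ℂ
  | 0 => !![0, 1; 1, 0]
  | 1 => !![0, -Complex.I; Complex.I, 0]
  | 2 => !![1, 0; 0, -1]

/-- The operator `σₖᵃ` on `𝔥_N`, acting as `σᵃ` on the `k`-th tensor factor
and as the identity on the others. -/
def siteOp (N : ℕ) (a : Fin 3) (k : Fin N) : Matrix (St N) (St N) ℂ :=
  Matrix.of fun x y =>
    pauli a (x k) (y k) * ∏ j ∈ Finset.univ.erase k, (if x j = y j then (1 : ℂ) else 0)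

/-- The L-operator `Lₖ(λ) = λ (I ⊗ 𝟙) + (i/2) Σₐ σᵃ ⊗ σₖᵃ` on `ℂ² ⊗ 𝔥_N`. -/
def Lop (N : ℕ) (lam : ℂ) (k : Fin N) : Matrix (Fin 2 × St N) (Fin 2 × St N) ℂ :=
  lam • (1 : Matrix (Fin 2 × St N) (Fin 2 × St N) ℂ) +
    (Complex.I / 2) • ∑ a : Fin 3,
      Matrix.of fun p q : Fin 2 × St N => pauli a p.1 q.1 * siteOp N a k p.2 q.2

/-- The monodromy matrix `T_N(λ) = L_N(λ) L_{N-1}(λ) ⋯ L_1(λ)`. -/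
def monodromy (N : ℕ) (lam : ℂ) : Matrix (Fin 2 × St N) (Fin 2 × St N) ℂ :=
  (((List.finRange N).reverse).map (Lop N lam)).prod

/-- `A_N(λ)`: the (0,0) block of `T_N(λ)` in the auxiliary space. -/
def Aop (N : ℕ) (lam : ℂ) : Matrix (St N) (St N) ℂ :=
  Matrix.of fun x y => monodromy N lam (0, x) (0, y)

/-- `B_N(λ)`: the (0,1) block of `T_N(λ)` in the auxiliary space. -/
def Bop (N : ℕ) (lam : ℂ) : Matrix (St N) (St N) ℂ :=
  Matrix.of fun x y => monodromy N lam (0, x) (1, y)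

/-- `C_N(λ)`: the (1,0) block of `T_N(λ)` in the auxiliary space. -/
def Cop (N : ℕ) (lam : ℂ) : Matrix (St N) (St N) ℂ :=
  Matrix.of fun x y => monodromy N lam (1, x) (0, y)

/-- `D_N(λ)`: the (1,1) block of `T_N(λ)` in the auxiliary space. -/
def Dop (N : ℕ) (lam : ℂ) : Matrix (St N) (St N) ℂ :=
  Matrix.of fun x y => monodromy N lam (1, x) (1, y)

/-- The transfer matrix `τ_N(λ) = A_N(λ) + D_N(λ)`. -/
def tau (N : ℕ) (lam : ℂ) : Matrix (St N) (St N) ℂ := Aop N lam + Dop N lam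

/-- The vacuum vector `|0⟩_N = v₊^{⊗N}`. -/
def vac (N : ℕ) : St N → ℂ := fun x => if x = (fun _ => (0 : Fin 2)) then 1 else 0

/-- Cyclic successor on `Fin N`, implementing periodic boundary conditions. -/
def cyc {N : ℕ} (k : Fin N) : Fin N := ⟨(k.1 + 1) % N, Nat.mod_lt _ k.pos⟩

/-- The XXX Hamiltonian
`ℋ_N = (J/4) Σₖ (σₖ¹σ_{k+1}¹ + σₖ²σ_{k+1}² + σₖ³σ_{k+1}³ − 𝟙)`. -/
def Ham (N : ℕ) (J : ℝ) : Matrix (St N) (St N) ℂ :=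
  ((J : ℂ) / 4) • ∑ k : Fin N,
    ((∑ a : Fin 3, siteOp N a k * siteOp N a (cyc k)) - 1)

/-- The product of creation operators `B_N(λ₁) ⋯ B_N(λ_ℓ)`. -/
def betheProd (N : ℕ) {l : ℕ} (lam : Fin l → ℂ) : Matrix (St N) (St N) ℂ :=
  ((List.finRange l).map fun j => Bop N (lam j)).prod

/-- The Bethe vector `B_N(λ₁) ⋯ B_N(λ_ℓ) |0⟩_N`. -/
def betheVec (N : ℕ) {l : ℕ} (lam : Fin l → ℂ) : St N → ℂ :=
  (betheProd N lam).mulVec (vac N)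

/-- The eigenvalue `Λ(λ; λ₁,…,λ_ℓ)` of the transfer matrix. -/
def Lam (N : ℕ) {l : ℕ} (lam0 : ℂ) (lam : Fin l → ℂ) : ℂ :=
  (lam0 + Complex.I / 2) ^ N * ∏ j, (lam0 - lam j - Complex.I) / (lam0 - lam j) +
    (lam0 - Complex.I / 2) ^ N * ∏ j, (lam j - lam0 - Complex.I) / (lam j - lam0)

/-- The unwanted-term coefficient `Λ_k(λ; λ₁,…,λ_ℓ)`. -/
def LamK (N : ℕ) {l : ℕ} (lam0 : ℂ) (lam : Fin l → ℂ) (k : Fin l) : ℂ :=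
  Complex.I / (lam0 - lam k) *
    ((lam k + Complex.I / 2) ^ N *
        ∏ j ∈ Finset.univ.erase k, (lam k - lam j - Complex.I) / (lam k - lam j) -
      (lam k - Complex.I / 2) ^ N *
        ∏ j ∈ Finset.univ.erase k, (lam j - lam k - Complex.I) / (lam j - lam k))

/-- The Bethe ansatz equations for the spin 1/2 XXX chain of length `N`. -/
def BetheEq (N : ℕ) {l : ℕ} (lam : Fin l → ℂ) : Prop :=
  ∀ k, ((lam k + Complex.I / 2) / (lam k - Complex.I / 2)) ^ N =
    ∏ j ∈ Finset.univ.erase k, (lam k - lam j + Complex.I) / (lam k - lam j - Complex.I)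

/-- Nepomechie–Wang regularization: `λ₁(ε) = i/2 + ε + c ε^N`. -/
def nwLam1 (N : ℕ) (c : ℂ) (eps : ℂ) : ℂ := Complex.I / 2 + eps + c * eps ^ N

/-- Nepomechie–Wang regularization: `λ₂(ε) = −i/2 + ε`. -/
def nwLam2 (eps : ℂ) : ℂ := -(Complex.I / 2) + eps

/-- The regularized tuple `(λ₁(ε), λ₂(ε), λ₃, …, λ_ℓ)`. -/
def nwTuple (N : ℕ) (c : ℂ) {m : ℕ} (mu : Fin m → ℂ) (eps : ℂ) : Fin (m + 2) → ℂ :=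
  Fin.cons (nwLam1 N c eps) (Fin.cons (nwLam2 eps) mu)

/-- The singular tuple `(i/2, −i/2, λ₃, …, λ_ℓ)`. -/
def singTuple {m : ℕ} (mu : Fin m → ℂ) : Fin (m + 2) → ℂ :=
  Fin.cons (Complex.I / 2) (Fin.cons (-(Complex.I / 2)) mu)

/-- The operator on `𝔥_N` acting as the matrix `M` on the `k`-th tensor factor. -/
def siteMatrix {N : ℕ} (k : Fin N) (M : Matrix (Fin 2) (Fin 2) ℂ) : Matrix (St N) (St N) ℂ :=
  Matrix.of fun x y =>
    M (x k) (y k) * ∏ j ∈ Finset.univ.erase k, (if x j = y j then (1 : ℂ) else 0)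

lemma siteMatrix_apply {N : ℕ} (k : Fin N) (M : Matrix (Fin 2) (Fin 2) ℂ) (x y : St N) :
    siteMatrix k M x y = if Function.update x k (y k) = y then M (x k) (y k) else 0 := by
  have hiff : Function.update x k (y k) = y ↔ ∀ j ∈ Finset.univ.erase k, x j = y j := by
    constructor
    · intro h j hj
      have := congrFun h j
      rwa [Function.update_of_ne (Finset.ne_of_mem_erase hj)] at this
    · intro h
      funext j
      by_cases hj : j = k
      · subst hj; simp
      · rw [Function.update_of_ne hj]; exact h j (by simp [hj])
  simp only [siteMatrix, Matrix.of_apply, Finset.prod_ite_zero, Finset.prod_const_one, hiff]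
  simp

lemma siteMatrix_mulVec {N : ℕ} (k : Fin N) (M : Matrix (Fin 2) (Fin 2) ℂ) (v : St N → ℂ)
    (x : St N) :
    (siteMatrix k M *ᵥ v) x = ∑ b, M (x k) b * v (Function.update x k b) := by
  have h : ∀ y, siteMatrix k M x y * v y =
      ∑ b, if y = Function.update x k b then M (x k) b * v (Function.update x k b) else 0 := by
    intro y
    rw [siteMatrix_apply, Finset.sum_eq_single (y k)]
    · by_cases hy : Function.update x k (y k) = y
      · rw [if_pos hy, if_pos hy.symm, hy]
      · rw [if_neg hy, if_neg (Ne.symm hy), zero_mul]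
    · intro b _ hb
      refine if_neg fun hy => hb ?_
      rw [hy, Function.update_self]
    · simp
  simp only [Matrix.mulVec, dotProduct, h]
  rw [Finset.sum_comm]
  simp

/-- `siteMatrix` as a homomorphism of algebras. -/
def siteHom {N : ℕ} (k : Fin N) :
    Matrix (Fin 2) (Fin 2) ℂ →ₐ[ℂ] Matrix (St N) (St N) ℂ :=
  AlgHom.ofLinearMap
    { toFun := siteMatrix k
      map_add' := fun M M' => by ext x y; simp [siteMatrix, add_mul]
      map_smul' := fun r M => by ext x y; simp [siteMatrix, mul_assoc] }
    (by
      apply Matrix.ext_of_mulVec_single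
      intro y
      ext x
      simp only [LinearMap.coe_mk, AddHom.coe_mk, siteMatrix_mulVec, Matrix.one_mulVec]
      simp [Matrix.one_apply])
    (fun M M' => by
      apply Matrix.ext_of_mulVec_single
      intro y
      ext x
      simp only [LinearMap.coe_mk, AddHom.coe_mk, ← Matrix.mulVec_mulVec, siteMatrix_mulVec,
        Matrix.mul_apply, Function.update_self, Function.update_idem, Finset.sum_mul,
        Finset.mul_sum]
      rw [Finset.sum_comm]
      simp only [mul_assoc])

lemma siteHom_apply {N : ℕ} (k : Fin N) (M : Matrix (Fin 2) (Fin 2) ℂ) :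
    siteHom k M = siteMatrix k M := rfl

lemma commute_siteHom {N : ℕ} {k m : Fin N} (hkm : k ≠ m) (M M' : Matrix (Fin 2) (Fin 2) ℂ) :
    Commute (siteHom k M) (siteHom m M') := by
  apply Matrix.ext_of_mulVec_single
  intro y
  ext x
  simp only [siteHom_apply, ← Matrix.mulVec_mulVec, siteMatrix_mulVec, Finset.mul_sum,
    Function.update_of_ne hkm, Function.update_of_ne hkm.symm]
  rw [Finset.sum_comm]
  refine Finset.sum_congr rfl fun b _ => Finset.sum_congr rfl fun b' _ => ?_
  rw [Function.update_comm hkm]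
  ring

/-- The RTT relation with the rational `R`-matrix, written in components. -/
def RTT {R : Type*} [Ring R] [Algebra ℂ R] (T : ℂ → Matrix (Fin 2) (Fin 2) R) : Prop :=
  ∀ u v a b c d,
    (u - v) • (T u a b * T v c d) + Complex.I • (T u c b * T v a d) =
      (u - v) • (T v c d * T u a b) + Complex.I • (T v c b * T u a d)

namespace RTT

variable {R : Type*} [Ring R] [Algebra ℂ R]

lemma one : RTT fun _ => (1 : Matrix (Fin 2) (Fin 2) R) := by
  intro u v a b c d
  simp only [Matrix.one_apply]
  congr 1
  split_ifs <;> simp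

lemma map {S : Type*} [Ring S] [Algebra ℂ S] {T : ℂ → Matrix (Fin 2) (Fin 2) R} (hT : RTT T)
    (φ : R →ₐ[ℂ] S) : RTT fun u => (T u).map φ := by
  intro u v a b c d
  simpa only [map_add, map_smul, map_mul, Matrix.map_apply] using congrArg φ (hT u v a b c d)

lemma mul {S T : ℂ → Matrix (Fin 2) (Fin 2) R} (hS : RTT S) (hT : RTT T)
    (hST : ∀ u v a b c d, Commute (S u a b) (T v c d)) : RTT fun u => S u * T u := by
  intro u v a b c d
  have hswap : ∀ u v a b c d, (S u * T u) a b * (S v * T v) c d =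
      ∑ x, ∑ y, S u a x * S v c y * (T u x b * T v y d) := by
    intro u v a b c d
    simp only [Matrix.mul_apply, Finset.sum_mul, Finset.mul_sum]
    rw [Finset.sum_comm]
    refine Finset.sum_congr rfl fun x _ => Finset.sum_congr rfl fun y _ => ?_
    rw [mul_assoc, ← mul_assoc (T u x b), ← (hST v u c y x b).eq]
    simp only [mul_assoc]
  have hswap' : ∀ u v a b c d, (S u * T u) a b * (S v * T v) c d =
      ∑ x, ∑ y, S u a y * S v c x * (T u y b * T v x d) := fun u v a b c d => by
    rw [hswap, Finset.sum_comm]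
  calc
    _ = ∑ x, ∑ y, ((u - v) • (S u a x * S v c y) + Complex.I • (S u c x * S v a y)) *
          (T u x b * T v y d) := by
      simp only [hswap, Finset.smul_sum, ← Finset.sum_add_distrib, add_mul, smul_mul_assoc]
    _ = ∑ x, ∑ y, (u - v) • (S v c y * S u a x * (T u x b * T v y d)) +
          ∑ x, ∑ y, Complex.I • (S v c x * S u a y * (T u x b * T v y d)) := by
      simp only [hS u v, ← Finset.sum_add_distrib, add_mul, smul_mul_assoc]
    _ = ∑ x, ∑ y, S v c y * S u a x *
          ((u - v) • (T u x b * T v y d) + Complex.I • (T u y b * T v x d)) := by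
      rw [Finset.sum_comm (f := fun x y => Complex.I • _)]
      simp only [← Finset.sum_add_distrib, mul_add, mul_smul_comm]
    _ = _ := by
      simp only [hT u v, hswap', Finset.smul_sum, ← Finset.sum_add_distrib, mul_add,
        mul_smul_comm]

variable {T : ℂ → Matrix (Fin 2) (Fin 2) R}

lemma commute_same (hT : RTT T) (a b : Fin 2) (u v : ℂ) : Commute (T u a b) (T v a b) := by
  have key : ∀ u v, u - v + Complex.I ≠ 0 → T u a b * T v a b = T v a b * T u a b := by
    intro u v h
    have := hT u v a b a b
    rw [← add_smul, ← add_smul] at this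
    exact smul_right_injective _ h this
  by_cases h : u - v + Complex.I = 0
  · refine (key v u fun h' => ?_).symm
    have : (2 : ℂ) * Complex.I = 0 := by linear_combination h + h'
    simp at this
  · exact key u v h

lemma diag_zero_mul (hT : RTT T) {u v : ℂ} (huv : u ≠ v) :
    T u 0 0 * T v 0 1 = (1 - Complex.I / (u - v)) • (T v 0 1 * T u 0 0) +
      (Complex.I / (u - v)) • (T u 0 1 * T v 0 0) := by
  have h := hT v u 0 1 0 0
  have h0 : v - u ≠ 0 := sub_ne_zero.2 huv.symm
  have h1 : u - v ≠ 0 := sub_ne_zero.2 huv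
  apply smul_right_injective _ h0
  have e1 : (v - u) * (1 - Complex.I / (u - v)) = (v - u) + Complex.I := by
    field_simp
    ring
  have e2 : (v - u) * (Complex.I / (u - v)) = -Complex.I := by
    field_simp
    ring
  simp only [smul_add, smul_smul, e1, e2, add_smul, neg_smul]
  rw [h]
  abel

lemma diag_one_mul (hT : RTT T) {u v : ℂ} (huv : u ≠ v) :
    T u 1 1 * T v 0 1 = (1 - -Complex.I / (u - v)) • (T v 0 1 * T u 1 1) +
      (-Complex.I / (u - v)) • (T u 0 1 * T v 1 1) := by
  have h := hT u v 1 1 0 1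
  have h1 : u - v ≠ 0 := sub_ne_zero.2 huv
  apply smul_right_injective _ h1
  have e1 : (u - v) * (1 - -Complex.I / (u - v)) = (u - v) + Complex.I := by
    field_simp
    ring
  have e2 : (u - v) * (-Complex.I / (u - v)) = -Complex.I := by
    field_simp
  simp only [smul_add, smul_smul, e1, e2, add_smul, neg_smul]
  rw [← add_neg_eq_iff_eq_add.2 h.symm]

end RTT

/-- The action of a diagonal monodromy entry `A` on a product of creation operators `B`:
one wanted term and a sum of unwanted terms. -/
lemma apply_bethe_product {V : Type*} [AddCommGroup V] [Module ℂ V] (A B : ℂ → Module.End ℂ V)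
    (α : ℂ → ℂ) (c : ℂ) (Φ : Finset ℂ → V)
    (hΦ : ∀ m s, m ∉ s → Φ (insert m s) = B m (Φ s))
    (hA : ∀ u, A u (Φ ∅) = α u • Φ ∅)
    (hB : ∀ u v, Commute (B u) (B v))
    (hAB : ∀ u v, u ≠ v → A u * B v =
      (1 - c / (u - v)) • (B v * A u) + (c / (u - v)) • (B u * A v))
    (s : Finset ℂ) : ∀ u ∉ s, A u (Φ s) = (α u * ∏ j ∈ s, (1 - c / (u - j))) • Φ s +
      ∑ k ∈ s, (c / (u - k) * (α k * ∏ j ∈ s.erase k, (1 - c / (k - j)))) •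
        B u (Φ (s.erase k)) := by
  induction s using Finset.induction_on with
  | empty => intro u _; simp [hA]
  | insert m s hm ih =>
    intro u hu
    obtain ⟨hum, hus⟩ : u ≠ m ∧ u ∉ s := by simpa using hu
    have hBB : ∀ x, B u (B m x) = B m (B u x) := fun x => LinearMap.congr_fun (hB u m).eq x
    have hunwanted : ∀ k ∈ s,
        (c / (u - k) * (α k * ∏ j ∈ (insert m s).erase k, (1 - c / (k - j)))) •
          B u (Φ ((insert m s).erase k)) =
        (1 - c / (u - m)) • (c / (u - k) * (α k * ∏ j ∈ s.erase k, (1 - c / (k - j)))) •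
          B m (B u (Φ (s.erase k))) +
        (c / (u - m)) • (c / (m - k) * (α k * ∏ j ∈ s.erase k, (1 - c / (k - j)))) •
          B m (B u (Φ (s.erase k))) := by
      intro k hk
      have hmk : m ≠ k := fun h => hm (h ▸ hk)
      have huk : u ≠ k := fun h => hus (h ▸ hk)
      have hms : m ∉ s.erase k := fun h => hm (Finset.mem_of_mem_erase h)
      rw [Finset.erase_insert_of_ne hmk, Finset.prod_insert hms, hΦ _ _ hms, hBB]
      simp only [smul_smul, ← add_smul]
      congr 1
      have h1 := sub_ne_zero.2 hum
      have h2 := sub_ne_zero.2 huk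
      have h3 := sub_ne_zero.2 hmk
      have h4 := sub_ne_zero.2 hmk.symm
      have : c / (u - k) * (1 - c / (k - m)) =
          (1 - c / (u - m)) * (c / (u - k)) + c / (u - m) * (c / (m - k)) := by
        rw [← neg_sub m k, div_neg]
        field_simp
        ring
      linear_combination (α k * ∏ j ∈ s.erase k, (1 - c / (k - j))) * this
    have hcomm := LinearMap.congr_fun (hAB u m hum) (Φ s)
    simp only [Module.End.mul_apply, LinearMap.add_apply, LinearMap.smul_apply] at hcomm
    rw [hΦ m s hm, hcomm, ih u hus, ih m hm, Finset.sum_insert hm, Finset.erase_insert hm,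
      Finset.prod_insert hm, Finset.sum_congr rfl hunwanted]
    simp only [map_add, map_sum, map_smul, hBB, smul_add, Finset.smul_sum,
      Finset.sum_add_distrib, smul_smul]
    rw [show (1 - c / (u - m)) * (α u * ∏ j ∈ s, (1 - c / (u - j))) =
      α u * ((1 - c / (u - m)) * ∏ j ∈ s, (1 - c / (u - j))) by ring]
    abel

/-- The local `L`-operator on `ℂ² ⊗ ℂ²`, as a matrix of matrices. -/
def localL (u : ℂ) : Matrix (Fin 2) (Fin 2) (Matrix (Fin 2) (Fin 2) ℂ) :=
  Matrix.of fun a b => (if a = b then u else 0) • 1 +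
    (Complex.I / 2) • ∑ s : Fin 3, pauli s a b • pauli s

lemma localL_eq (u : ℂ) : localL u =
    !![!![u + Complex.I / 2, 0; 0, u - Complex.I / 2], !![0, 0; Complex.I, 0];
       !![0, Complex.I; 0, 0], !![u - Complex.I / 2, 0; 0, u + Complex.I / 2]] := by
  ext a b x y
  fin_cases a <;> fin_cases b <;> fin_cases x <;> fin_cases y <;>
    simp [localL, pauli, Fin.sum_univ_three] <;> ring

lemma rtt_localL : RTT localL := by
  intro u v a b c d
  simp only [localL_eq]
  ext x y
  fin_cases a <;> fin_cases b <;> fin_cases c <;> fin_cases d <;> fin_cases x <;> fin_cases y <;>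
    simp [-mul_eq_mul_left_iff] <;>
    first
    | ring1
    | linear_combination (u - v) * Complex.I_sq
    | linear_combination (v - u) * Complex.I_sq

/-- The `L`-operator at site `k` as a `2 × 2` matrix with operator entries. -/
def blockL {N : ℕ} (k : Fin N) (u : ℂ) : Matrix (Fin 2) (Fin 2) (Matrix (St N) (St N) ℂ) :=
  (localL u).map (siteHom k)

lemma compRingEquiv_blockL {N : ℕ} (k : Fin N) (u : ℂ) :
    Matrix.compRingEquiv (Fin 2) (St N) ℂ (blockL k u) = Lop N u k := by
  ext ⟨a, x⟩ ⟨b, y⟩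
  simp only [Matrix.compRingEquiv_apply, Matrix.comp_apply, blockL, Matrix.map_apply, localL,
    Matrix.of_apply, map_add, map_smul, map_sum, map_one, Lop, Matrix.add_apply,
    Matrix.smul_apply, Matrix.sum_apply, Matrix.one_apply, Prod.mk.injEq]
  congr 1
  by_cases h : a = b <;> simp [h]

/-- The monodromy matrix along a list of sites, as a `2 × 2` matrix with operator entries. -/
def blockT {N : ℕ} (L : List (Fin N)) (u : ℂ) :
    Matrix (Fin 2) (Fin 2) (Matrix (St N) (St N) ℂ) :=
  (L.map fun k => blockL k u).prod

lemma blockT_cons {N : ℕ} (k : Fin N) (L : List (Fin N)) (u : ℂ) :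
    blockT (k :: L) u = blockL k u * blockT L u := by
  simp [blockT]

lemma monodromy_eq (N : ℕ) (u : ℂ) :
    monodromy N u =
      Matrix.compRingEquiv (Fin 2) (St N) ℂ (blockT (List.finRange N).reverse u) := by
  rw [blockT, map_list_prod, List.map_map, monodromy]
  congr 2
  funext k
  exact (compRingEquiv_blockL k u).symm

lemma commute_siteHom_blockT {N : ℕ} (k : Fin N) (M : Matrix (Fin 2) (Fin 2) ℂ) (u : ℂ)
    (L : List (Fin N)) (hk : k ∉ L) (a b : Fin 2) : Commute (siteHom k M) (blockT L u a b) := by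
  induction L generalizing a b with
  | nil =>
    simp only [blockT, List.map_nil, List.prod_nil, Matrix.one_apply]
    split_ifs <;> simp
  | cons m L ih =>
    simp only [List.mem_cons, not_or] at hk
    rw [blockT_cons, Matrix.mul_apply]
    exact Commute.sum_right _ _ _ fun x _ =>
      (commute_siteHom hk.1 _ _).mul_right (ih hk.2 x b)

lemma rtt_blockT {N : ℕ} (L : List (Fin N)) (hL : L.Nodup) : RTT (blockT L) := by
  induction L with
  | nil => exact RTT.one
  | cons k L ih =>
    rw [List.nodup_cons] at hL
    have h := (rtt_localL.map (siteHom k)).mul (ih hL.2) fun u v a b c d =>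
      commute_siteHom_blockT k _ v L hL.1 c d
    intro u v a b c d
    simp only [blockT_cons]
    exact h u v a b c d

lemma vac_update_one {N : ℕ} (x : St N) (k : Fin N) : vac N (Function.update x k 1) = 0 := by
  refine if_neg fun h => ?_
  simpa using congrFun h k

lemma siteHom_mulVec_vac {N : ℕ} (k : Fin N) (M : Matrix (Fin 2) (Fin 2) ℂ) (hM : M 1 0 = 0) :
    siteHom k M *ᵥ vac N = M 0 0 • vac N := by
  ext x
  rw [siteHom_apply, siteMatrix_mulVec, Fin.sum_univ_two, vac_update_one, mul_zero, add_zero,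
    Pi.smul_apply, smul_eq_mul]
  have hx := Function.update_eq_self k x
  rcases em (x k = 0) with h | h
  · rw [h] at hx ⊢
    rw [hx]
  · replace h := Fin.eq_one_of_ne_zero _ h
    have hv := vac_update_one x k
    rw [h] at hx ⊢
    rw [hx] at hv
    rw [hM, hv, zero_mul, mul_zero]

lemma blockT_mulVec_vac {N : ℕ} (u : ℂ) (L : List (Fin N)) (hL : L.Nodup) :
    blockT L u 0 0 *ᵥ vac N = (u + Complex.I / 2) ^ L.length • vac N ∧
    blockT L u 1 0 *ᵥ vac N = 0 ∧
    blockT L u 1 1 *ᵥ vac N = (u - Complex.I / 2) ^ L.length • vac N := by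
  induction L with
  | nil => simp [blockT]
  | cons k L ih =>
    rw [List.nodup_cons] at hL
    obtain ⟨hA, hC, hD⟩ := ih hL.2
    have hk : ∀ a b, localL u a b 1 0 = 0 →
        blockL k u a b *ᵥ vac N = localL u a b 0 0 • vac N := fun a b h =>
      siteHom_mulVec_vac k _ h
    have h00 := hk 0 0 (by simp [localL_eq])
    have h10 := hk 1 0 (by simp [localL_eq])
    have h11 := hk 1 1 (by simp [localL_eq])
    have hcomm : blockL k u 1 0 * blockT L u 0 1 = blockT L u 0 1 * blockL k u 1 0 :=
      commute_siteHom_blockT k _ u L hL.1 0 1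
    simp only [localL_eq, Matrix.of_apply, Matrix.cons_val_zero, Matrix.cons_val_one,
      Matrix.cons_val', zero_smul] at h00 h10 h11
    simp only [blockT_cons, Matrix.mul_apply, Fin.sum_univ_two, hcomm, Matrix.add_mulVec,
      ← Matrix.mulVec_mulVec, hA, hC, hD, Matrix.mulVec_smul, h00, h10, h11, Matrix.mulVec_zero,
      smul_smul, smul_zero, add_zero, zero_add, List.length_cons, pow_succ, and_self]

/-- For solutions of the Bethe ansatz equations, the Bethe vector is an
eigenvector of the transfer matrix with eigenvalue `Λ(λ; λ₁,…,λ_ℓ)`. -/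
theorem bethe_vector_transfer_eigenvector (N : ℕ) (hN : 1 ≤ N) {l : ℕ}
    (lam : Fin l → ℂ) (hinj : Function.Injective lam)
    (hhalf : ∀ k, lam k ≠ Complex.I / 2)
    (hstr : ∀ j k : Fin l, j ≠ k → lam k - lam j ≠ Complex.I)
    (hBAE : BetheEq N lam)
    (lam0 : ℂ) (h0 : ∀ j, lam0 ≠ lam j) :
    (tau N lam0).mulVec (betheVec N lam) = Lam N lam0 lam • betheVec N lam := by
  set T : ℂ → Matrix (Fin 2) (Fin 2) (Matrix (St N) (St N) ℂ) :=
    blockT (List.finRange N).reverse with hTdef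
  have hnd : (List.finRange N).reverse.Nodup := List.nodup_reverse.2 (List.nodup_finRange N)
  have hT : RTT T := rtt_blockT _ hnd
  have hvac := fun u => blockT_mulVec_vac u _ hnd
  simp only [← hTdef, List.length_reverse, List.length_finRange] at hvac
  have hAop : ∀ u, Aop N u = T u 0 0 := fun u => by
    ext x y; simp only [Aop, Matrix.of_apply, monodromy_eq]; rfl
  have hBop : ∀ u, Bop N u = T u 0 1 := fun u => by
    ext x y; simp only [Bop, Matrix.of_apply, monodromy_eq]; rfl
  have hDop : ∀ u, Dop N u = T u 1 1 := fun u => by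
    ext x y; simp only [Dop, Matrix.of_apply, monodromy_eq]; rfl
  have hB : ∀ u v, Commute (T u 0 1) (T v 0 1) := hT.commute_same 0 1
  let P : Finset ℂ → Matrix (St N) (St N) ℂ := fun s =>
    s.noncommProd (fun u => T u 0 1) fun u _ v _ _ => hB u v
  let Φ : Finset ℂ → St N → ℂ := fun s => P s *ᵥ vac N
  have hΦ : ∀ m s, m ∉ s → Φ (insert m s) = Matrix.toLinAlgEquiv' (T m 0 1) (Φ s) := by
    intro m s hm
    have hP : P (insert m s) = T m 0 1 * P s :=
      Finset.noncommProd_insert_of_notMem _ _ _ _ hm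
    simp only [Φ, Matrix.toLinAlgEquiv'_apply, Matrix.mulVec_mulVec, hP]
  have hΦ0 : Φ ∅ = vac N := by
    have hP : P ∅ = 1 := Finset.noncommProd_empty _ _
    simp only [Φ, hP, Matrix.one_mulVec]
  have hA := apply_bethe_product (fun u => Matrix.toLinAlgEquiv' (T u 0 0))
    (fun u => Matrix.toLinAlgEquiv' (T u 0 1)) (fun u => (u + Complex.I / 2) ^ N) Complex.I Φ hΦ
    (fun u => by simp only [hΦ0, Matrix.toLinAlgEquiv'_apply, hvac])
    (fun u v => (hB u v).map Matrix.toLinAlgEquiv')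
    (fun u v huv => by simp only [← map_mul, hT.diag_zero_mul huv, map_add, map_smul])
  have hD := apply_bethe_product (fun u => Matrix.toLinAlgEquiv' (T u 1 1))
    (fun u => Matrix.toLinAlgEquiv' (T u 0 1)) (fun u => (u - Complex.I / 2) ^ N) (-Complex.I) Φ
    hΦ (fun u => by simp only [hΦ0, Matrix.toLinAlgEquiv'_apply, hvac])
    (fun u v => (hB u v).map Matrix.toLinAlgEquiv')
    (fun u v huv => by simp only [← map_mul, hT.diag_one_mul huv, map_add, map_smul])
  set s : Finset ℂ := Finset.univ.image lam with hs
  have h0s : lam0 ∉ s := by simpa [hs, eq_comm] using h0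
  have hvec : betheVec N lam = Φ s := by
    have hlist : s = ((List.finRange l).map lam).toFinset := by ext; simp [hs]
    have hP : P ((List.finRange l).map lam).toFinset =
        (((List.finRange l).map lam).map fun u => T u 0 1).prod :=
      Finset.noncommProd_toFinset _ _ _ ((List.nodup_finRange l).map hinj)
    simp only [betheVec, betheProd, Φ, hlist, hBop, hP, List.map_map, Function.comp_def]
  have hfun : ∀ x y c : ℂ, x ≠ y → 1 - c / (x - y) = (x - y - c) / (x - y) := by
    intro x y c h
    rw [sub_div, div_self (sub_ne_zero.2 h)]
  have hfun' : ∀ x y : ℂ, x ≠ y →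
      1 - -Complex.I / (x - y) = (y - x - Complex.I) / (y - x) := by
    intro x y h
    rw [sub_div, div_self (sub_ne_zero.2 h.symm), ← neg_sub y x, neg_div_neg_eq]
  have hLam : Lam N lam0 lam =
      (lam0 + Complex.I / 2) ^ N * ∏ j ∈ s, (1 - Complex.I / (lam0 - j)) +
      (lam0 - Complex.I / 2) ^ N * ∏ j ∈ s, (1 - -Complex.I / (lam0 - j)) := by
    rw [Lam, hs, Finset.prod_image hinj.injOn, Finset.prod_image hinj.injOn]
    congr 2 <;> refine Finset.prod_congr rfl fun j _ => ?_
    · rw [hfun _ _ _ (h0 j)]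
    · rw [hfun' _ _ (h0 j)]
  have hbethe : ∀ k ∈ s,
      (k + Complex.I / 2) ^ N * ∏ j ∈ s.erase k, (1 - Complex.I / (k - j)) =
      (k - Complex.I / 2) ^ N * ∏ j ∈ s.erase k, (1 - -Complex.I / (k - j)) := by
    intro k hk
    obtain ⟨k, -, rfl⟩ := Finset.mem_image.1 hk
    have hne : ∀ j ∈ Finset.univ.erase k, lam k ≠ lam j := fun j hj h =>
      Finset.ne_of_mem_erase hj (hinj h).symm
    rw [hs, ← Finset.image_erase hinj, Finset.prod_image hinj.injOn,
      Finset.prod_image hinj.injOn]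
    have h := hBAE k
    have hden : (lam k - Complex.I / 2) ^ N ≠ 0 := pow_ne_zero _ (sub_ne_zero.2 (hhalf k))
    rw [div_pow, div_eq_iff hden] at h
    rw [h, mul_right_comm, mul_comm, ← Finset.prod_mul_distrib]
    congr 1
    refine Finset.prod_congr rfl fun j hj => ?_
    have h1 := sub_ne_zero.2 (hne j hj)
    have h2 : lam k - lam j - Complex.I ≠ 0 :=
      sub_ne_zero.2 (hstr j k (Finset.ne_of_mem_erase hj))
    rw [hfun _ _ _ (hne j hj), hfun _ _ _ (hne j hj), sub_neg_eq_add]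
    field_simp
  have hA0 := hA s lam0 h0s
  have hD0 := hD s lam0 h0s
  simp only [Matrix.toLinAlgEquiv'_apply] at hA0 hD0
  rw [hvec, tau, hAop, hDop, Matrix.add_mulVec, hA0, hD0, hLam, add_smul, add_add_add_comm,
    ← Finset.sum_add_distrib, Finset.sum_eq_zero, add_zero]
  intro k hk
  rw [hbethe k hk, ← add_smul, neg_div, neg_mul, add_neg_cancel, zero_smul]
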